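/- Let m, n ≥ 1 with m + n ≥ 3, and let i, j be distinct edges of the complete bipartite graph K_{m,n} with parts X (size m) and Y (size n). The number h_{ij} of spanning trees of K_{m,n} containing both i and j equals n^{m−3} m^{n−3} · n(2m+n−2) if i and j share a vertex in X, equals n^{m−3} m^{n−3} · m(2n+m−2) if they share a vertex in Y, and equals n^{m−3} m^{n−3} · (m+n)(m+n−2) if they are vertex-disjoint. -/

import Mathlib

open Finset

/-- A partial function is acyclic if iterating it from any point eventually leaves the domain. -/
def AcyclicFun {α : Type*} (g : α → Option α) : Prop :=
  WellFounded fun b a => g a = some b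

/-- Redirect every value `some none` of `q` to the vertex `q y`. -/
def contractAt {α β : Type*} (q : β → Option (Option α)) (y : β) : β → Option α :=
  fun z => (q z).elim none fun o => o.elim (q y).join some

theorem acyclicFun_option_iff {α β : Type*} (q : β → Option (Option α)) (p : Option α → β) :
    AcyclicFun (q ∘ p) ↔
      q (p none) ≠ some none ∧ AcyclicFun (contractAt q (p none) ∘ p ∘ some) := by
  constructor
  · intro h
    refine ⟨fun h0 => h.irrefl.irrefl none h0, ?_⟩
    refine Subrelation.wf ?_ (InvImage.wf some h.transGen)
    intro b a hba
    simp only [Function.comp_apply, contractAt] at hba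
    rcases hq : q (p (some a)) with _ | _ | c
    · simp [hq] at hba
    · rw [hq] at hba
      refine Relation.TransGen.head (b := none) ?_ (.single hq)
      rcases hn : q (p none) with _ | _ | d <;> simp [hn] at hba
      simp [hn, hba]
    · simp only [hq, Option.elim_some, Option.some.injEq] at hba
      exact .single (by simp [hq, hba])
  · rintro ⟨h0, h⟩
    have hsome (a : α) : Acc (fun b a => (q ∘ p) a = some b) (some a) := by
      induction a using h.induction with
      | _ a ih =>
      refine ⟨_, fun b hb => ?_⟩
      simp only [Function.comp_apply] at hb
      rcases b with _ | b
      · refine ⟨_, fun c hc => ?_⟩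
        simp only [Function.comp_apply] at hc
        rcases c with _ | c
        · exact absurd hc h0
        · exact ih c (by simp [contractAt, hb, hc])
      · exact ih b (by simp [contractAt, hb])
    refine ⟨fun a => ?_⟩
    rcases a with _ | a
    · refine ⟨_, fun c hc => ?_⟩
      rcases c with _ | c
      · exact absurd hc h0
      · exact hsome c
    · exact hsome a

theorem card_contractAt_eq_none {α β : Type*} [Fintype β] (q : β → Option (Option α)) (y : β)
    (hy : q y ≠ some none) :
    Nat.card {z // contractAt q y z = none} = Nat.card {z // q z = none} +
      if q y = none then Nat.card {z // q z = some none} else 0 := by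
  classical
  simp only [Nat.card_eq_fintype_card, Fintype.card_subtype]
  split_ifs with h
  · rw [← Finset.card_union_of_disjoint]
    · congr 1
      ext z
      rcases hz : q z with _ | _ | c <;> simp [contractAt, hz, h]
    · rw [Finset.disjoint_filter]
      intro z _ h1 h2
      simp [h1] at h2
  · congr 1
    ext z
    obtain ⟨c, hc⟩ : ∃ c, q y = some (some c) := by
      rcases hq : q y with _ | _ | c <;> simp_all
    rcases hz : q z with _ | _ | d <;> simp [contractAt, hz, hc]

theorem card_mul_card_acyclicFun {α β : Type*} [Finite α] [Fintype β] (q : β → Option α) :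
    Nat.card β * Nat.card {p : α → β // AcyclicFun (q ∘ p)} =
      Nat.card {y // q y = none} * Nat.card β ^ Nat.card α := by
  classical
  induction α using Finite.induction_empty_option with
  | of_equiv e ih =>
    rename_i α α'
    have := ih (Option.map e.symm ∘ q)
    rw [Nat.card_congr e] at this
    simp only [Function.comp_apply, Option.map_eq_none_iff] at this
    rw [← this]
    congr 1
    refine Nat.card_congr (Equiv.subtypeEquiv (e.arrowCongr (.refl β)).symm fun p => ?_)
    constructor
    · intro h
      refine Subrelation.wf ?_ (InvImage.wf e h)
      intro b a hab
      simp at hab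
      obtain ⟨c, hc, rfl⟩ := hab
      simpa [InvImage] using hc
    · intro h
      refine Subrelation.wf ?_ (InvImage.wf e.symm h)
      intro b a hab
      simp at hab
      simp [InvImage, hab]
  | h_empty =>
    have : ∀ y, q y = none := fun y => Subsingleton.elim _ _
    have h : ∀ p : PEmpty → β, AcyclicFun (q ∘ p) := fun p => ⟨fun a => a.elim⟩
    simp [this, h]
  | h_option ih =>
    rename_i α _
    have key : Nat.card {p : Option α → β // AcyclicFun (q ∘ p)} =
        ∑ y, if q y = some none then 0
          else Nat.card {p : α → β // AcyclicFun (contractAt q y ∘ p)} := by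
      let E : {p : Option α → β // AcyclicFun (q ∘ p)} ≃
          Σ y, {p : α → β // q y ≠ some none ∧ AcyclicFun (contractAt q y ∘ p)} :=
        { toFun := fun p => ⟨p.1 none, p.1 ∘ some, (acyclicFun_option_iff q p.1).1 p.2⟩
          invFun := fun s => ⟨fun o => o.elim s.1 s.2.1, (acyclicFun_option_iff q _).2 s.2.2⟩
          left_inv := fun p => by
            ext o
            cases o <;> rfl
          right_inv := fun s => rfl }
      rw [Nat.card_congr E, Nat.card_sigma]
      refine Finset.sum_congr rfl fun y _ => ?_
      split_ifs with h <;> simp [h]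
    rw [key, Finset.mul_sum]
    set c := Nat.card {z // q z = none} with hc
    set u := Nat.card {z // q z = some none} with hu
    have hterm (y : β) : Nat.card β * (if q y = some none then 0
          else Nat.card {p : α → β // AcyclicFun (contractAt q y ∘ p)}) +
          (if q y = some none then c * Nat.card β ^ Nat.card α else 0) =
        (c + if q y = none then u else 0) * Nat.card β ^ Nat.card α := by
      by_cases h : q y = some none
      · simp [h]
      · rw [if_neg h, if_neg h, add_zero, ih, card_contractAt_eq_none q y h]
    have hsum := Finset.sum_congr (rfl : (Finset.univ : Finset β) = _) fun y _ => hterm y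
    rw [Finset.sum_add_distrib, ← Finset.sum_mul, Finset.sum_add_distrib,
      ← Finset.sum_filter, ← Finset.sum_filter, Finset.sum_const, Finset.sum_const,
      Finset.sum_const, ← Fintype.card_subtype, ← Fintype.card_subtype,
      ← Nat.card_eq_fintype_card, ← Nat.card_eq_fintype_card, ← hc, ← hu, Finset.card_univ,
      ← Nat.card_eq_fintype_card] at hsum
    simp only [smul_eq_mul] at hsum
    rw [Finite.card_option, pow_succ]
    linarith

theorem card_fun_eq_none_on {α β : Type*} [Fintype α] [Fintype β] [DecidableEq α]
    [DecidableEq β] (S : Finset β) :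
    #{q : β → Option α | ∀ y ∈ S, q y = none} = (Fintype.card α + 1) ^ #Sᶜ := by
  have : ({q : β → Option α | ∀ y ∈ S, q y = none} : Finset _) =
      Fintype.piFinset fun y => if y ∈ S then {none} else univ := by
    ext q
    simp only [mem_filter, mem_univ, true_and, Fintype.mem_piFinset]
    refine forall_congr' fun y => ?_
    split_ifs with h <;> simp [h]
  rw [this, Fintype.card_piFinset]
  simp only [apply_ite Finset.card, card_singleton, card_univ, Fintype.card_option]
  rw [prod_ite]
  simp [← Finset.filter_notMem_eq_sdiff, Finset.compl_eq_univ_sdiff]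

theorem sum_card_fiber_none {α β : Type*} [Fintype α] [Fintype β] [DecidableEq α]
    [DecidableEq β] (S : Finset β) :
    (Fintype.card α + 1) * ∑ q : β → Option α with ∀ y ∈ S, q y = none, #{y | q y = none} =
      (Fintype.card α + 1) ^ #Sᶜ * (#S * (Fintype.card α + 1) + #Sᶜ) := by
  have hz (z : β) : (Fintype.card α + 1) *
      #{q : β → Option α | (∀ y ∈ S, q y = none) ∧ q z = none} =
      (Fintype.card α + 1) ^ #Sᶜ * if z ∈ S then Fintype.card α + 1 else 1 := by
    have h : ({q : β → Option α | (∀ y ∈ S, q y = none) ∧ q z = none} : Finset _) =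
        ({q : β → Option α | ∀ y ∈ insert z S, q y = none} : Finset _) := by
      ext q
      simp [and_comm]
    rw [h, card_fun_eq_none_on]
    split_ifs with hzS
    · rw [insert_eq_of_mem hzS, mul_comm]
    · rw [compl_insert, mul_one, ← pow_succ', card_erase_add_one (by simpa using hzS)]
  simp only [card_filter _ univ]
  rw [sum_comm, mul_sum]
  simp only [← card_filter, filter_filter, hz]
  rw [← mul_sum, sum_ite]
  simp [compl_eq_univ_sdiff, Finset.filter_notMem_eq_sdiff, mul_comm]

/-- The number of pairs of parent maps `p : α → β`, `q : β → Option α` describing a tree rooted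
at `none` in which all vertices of `S` are children of the root. -/
theorem card_parentMaps {α β : Type*} [Fintype α] [Fintype β] (S : Finset β) :
    Fintype.card β * (Fintype.card α + 1) *
        Nat.card {f : (α → β) × (β → Option α) //
          AcyclicFun (f.2 ∘ f.1) ∧ ∀ y ∈ S, f.2 y = none} =
      Fintype.card β ^ Fintype.card α * (Fintype.card α + 1) ^ (Fintype.card β - #S) *
        (#S * (Fintype.card α + 1) + (Fintype.card β - #S)) := by
  classical
  have key : Nat.card {f : (α → β) × (β → Option α) //
        AcyclicFun (f.2 ∘ f.1) ∧ ∀ y ∈ S, f.2 y = none} =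
      ∑ q : β → Option α with ∀ y ∈ S, q y = none,
        Nat.card {p : α → β // AcyclicFun (q ∘ p)} := by
    let E : {f : (α → β) × (β → Option α) //
        AcyclicFun (f.2 ∘ f.1) ∧ ∀ y ∈ S, f.2 y = none} ≃
        Σ q : β → Option α, {p : α → β // AcyclicFun (q ∘ p) ∧ ∀ y ∈ S, q y = none} :=
      { toFun := fun f => ⟨f.1.2, f.1.1, f.2⟩
        invFun := fun s => ⟨(s.2.1, s.1), s.2.2⟩
        left_inv := fun _ => rfl
        right_inv := fun _ => rfl }
    rw [Nat.card_congr E, Nat.card_sigma, sum_filter]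
    refine sum_congr rfl fun q _ => ?_
    split_ifs with h
    · exact Nat.card_congr (Equiv.subtypeEquivRight fun p => and_iff_left h)
    · simp [h]
  have h1 (q : β → Option α) :
      Fintype.card β * Nat.card {p : α → β // AcyclicFun (q ∘ p)} =
        #{y | q y = none} * Fintype.card β ^ Fintype.card α := by
    simpa only [Nat.card_eq_fintype_card, Fintype.card_subtype] using card_mul_card_acyclicFun q
  rw [key, mul_right_comm, mul_sum, sum_congr rfl fun q _ => h1 q, ← sum_mul]
  have h2 := sum_card_fiber_none (α := α) S
  rw [card_compl] at h2
  linear_combination Fintype.card β ^ Fintype.card α * h2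

/-- The bipartite graph in which each `a : α` is joined to `p a` and each `b : β` to `q b`. -/
def parentGraph {α β : Type*} (p : α → β) (q : β → Option α) : SimpleGraph (Option α ⊕ β) :=
  .fromEdgeSet (Set.range (fun a => s(.inl (some a), .inr (p a))) ∪
    Set.range fun y => s(.inl (q y), .inr y))

theorem parentGraph_adj {α β : Type*} (p : α → β) (q : β → Option α) (x : Option α) (y : β) :
    (parentGraph p q).Adj (.inl x) (.inr y) ↔ (∃ a, x = some a ∧ p a = y) ∨ q y = x := by
  simp [parentGraph, eq_comm]

theorem parentGraph_le {α β : Type*} (p : α → β) (q : β → Option α) :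
    parentGraph p q ≤ completeBipartiteGraph (Option α) β := by
  rintro (x | x) (y | y) <;> simp [parentGraph]

theorem parentGraph_connected {α β : Type*} {p : α → β} {q : β → Option α}
    (h : AcyclicFun (q ∘ p)) : (parentGraph p q).Connected := by
  have hα (a : α) : (parentGraph p q).Reachable (.inl (some a)) (.inl none) := by
    induction a using h.induction with
    | _ a ih =>
    have h1 : (parentGraph p q).Adj (.inl (some a)) (.inr (p a)) := by simp [parentGraph_adj]
    have h2 : (parentGraph p q).Adj (.inl (q (p a))) (.inr (p a)) := by simp [parentGraph_adj]
    refine h1.reachable.trans (h2.symm.reachable.trans ?_)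
    rcases hq : q (p a) with _ | b
    · rfl
    · exact ih b hq
  have hr (v : Option α ⊕ β) : (parentGraph p q).Reachable v (.inl none) := by
    rcases v with (_ | a) | y
    · rfl
    · exact hα a
    · have h2 : (parentGraph p q).Adj (.inl (q y)) (.inr y) := by simp [parentGraph_adj]
      refine h2.symm.reachable.trans ?_
      rcases q y with _ | b
      · rfl
      · exact hα b
  exact { preconnected := fun u v => (hr u).trans (hr v).symm, nonempty := ⟨.inl none⟩ }

theorem parentGraph_isTree {α β : Type*} [Finite α] [Finite β] {p : α → β} {q : β → Option α}
    (h : AcyclicFun (q ∘ p)) : (parentGraph p q).IsTree := by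
  have hc := parentGraph_connected h
  refine SimpleGraph.isTree_iff_connected_and_card.2 ⟨hc, le_antisymm ?_
    hc.card_vert_le_card_edgeSet_add_one⟩
  have h1 : (parentGraph p q).edgeSet.ncard ≤ Nat.card α + Nat.card β := by
    refine (Set.ncard_le_ncard (t := Set.range (fun a => s(.inl (some a), .inr (p a))) ∪
      Set.range fun y => s(.inl (q y), .inr y)) ?_).trans ?_
    · rw [parentGraph, SimpleGraph.edgeSet_fromEdgeSet]
      exact Set.sdiff_subset
    refine (Set.ncard_union_le _ _).trans (add_le_add ?_ ?_)
    · rw [← Set.image_univ, ← Set.ncard_univ]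
      exact Set.ncard_image_le
    · rw [← Set.image_univ, ← Set.ncard_univ]
      exact Set.ncard_image_le
  rw [Nat.card_sum, Finite.card_option, Nat.card_coe_set_eq]
  omega

theorem eq_of_parentGraph_eq {α β : Type*} {p p' : α → β} {q q' : β → Option α}
    (h' : AcyclicFun (q' ∘ p')) (heq : parentGraph p q = parentGraph p' q') :
    p = p' ∧ q = q' := by
  have hadj (x : Option α) (y : β) : ((∃ a, x = some a ∧ p a = y) ∨ q y = x) ↔
      ((∃ a, x = some a ∧ p' a = y) ∨ q' y = x) := by
    rw [← parentGraph_adj, heq, parentGraph_adj]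
  have hp (a : α) : p a = p' a := by
    induction a using h'.induction with
    | _ a ih =>
    by_contra hne
    have h1 : q (p' a) = some a := by
      have := (hadj (some a) (p' a)).2 (.inl ⟨a, rfl, rfl⟩)
      simpa [hne] using this
    have h2 := (hadj (q' (p' a)) (p' a)).2 (.inr rfl)
    rcases h2 with ⟨b, hb, hpb⟩ | h2
    · have h3 : p' b = p' a := (ih b hb).symm.trans hpb
      exact h'.irrefl.irrefl b (by simp [h3, hb])
    · exact h'.irrefl.irrefl a (by simp [← h2, h1])
  have hpp : p = p' := funext hp
  refine ⟨hpp, funext fun y => ?_⟩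
  subst hpp
  rcases (hadj (q y) y).1 (.inr rfl) with ⟨a, ha, hpa⟩ | h
  · rcases (hadj (q' y) y).2 (.inr rfl) with ⟨b, hb, hpb⟩ | h
    · exact absurd (by simp [hpb, hb]) (h'.irrefl.irrefl b)
    · exact h
  · exact h.symm

theorem exists_adj_dist_lt {V : Type*} {G : SimpleGraph V} (hG : G.Connected) {r v : V}
    (hv : v ≠ r) : ∃ w, G.Adj v w ∧ G.dist w r < G.dist v r := by
  obtain ⟨w, hw⟩ := hG.exists_walk_length_eq_dist v r
  cases w with
  | nil => exact absurd rfl hv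
  | cons h w =>
    refine ⟨_, h, ?_⟩
    rw [← hw, SimpleGraph.Walk.length_cons]
    exact Nat.lt_succ_of_le (SimpleGraph.dist_le w)

theorem exists_parentGraph_eq {α β : Type*} {T : SimpleGraph (Option α ⊕ β)}
    (hT : T.IsTree) (hle : T ≤ completeBipartiteGraph (Option α) β) :
    ∃ (p : α → β) (q : β → Option α), AcyclicFun (q ∘ p) ∧ parentGraph p q = T := by
  have hp (a : α) : ∃ y : β, T.Adj (.inl (some a)) (.inr y) ∧
      T.dist (.inr y) (.inl none) < T.dist (.inl (some a)) (.inl none) := by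
    obtain ⟨w, hw, hd⟩ := exists_adj_dist_lt hT.connected
      (v := (.inl (some a) : Option α ⊕ β)) (r := .inl none) (by simp)
    rcases w with w | w
    · simpa using hle hw
    · exact ⟨w, hw, hd⟩
  have hq (y : β) : ∃ x : Option α, T.Adj (.inl x) (.inr y) ∧
      T.dist (.inl x) (.inl none) < T.dist (.inr y) (.inl none) := by
    obtain ⟨w, hw, hd⟩ := exists_adj_dist_lt hT.connected
      (v := (.inr y : Option α ⊕ β)) (r := .inl none) (by simp)
    rcases w with w | w
    · exact ⟨w, hw.symm, hd⟩
    · simpa using hle hw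
  choose p hp hpd using hp
  choose q hq hqd using hq
  have hac : AcyclicFun (q ∘ p) := by
    refine Subrelation.wf ?_
      (InvImage.wf (fun a => T.dist (.inl (some a)) (.inl none)) Nat.lt_wfRel.wf)
    intro b a hab
    simp only [Function.comp_apply] at hab
    have := hqd (p a)
    rw [hab] at this
    exact this.trans (hpd a)
  refine ⟨p, q, hac, ?_⟩
  have hsub : parentGraph p q ≤ T := by
    rw [parentGraph, SimpleGraph.fromEdgeSet_le]
    rintro e ⟨⟨a, rfl⟩ | ⟨y, rfl⟩, -⟩
    · exact hp a
    · exact hq y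
  exact le_antisymm hsub
    ((SimpleGraph.isTree_iff_minimal_connected.1 hT).2 (parentGraph_connected hac) hsub)

/-- The spanning trees of `G` that contain all edges in `A`. -/
def spanningTreesContaining {V : Type*} (G : SimpleGraph V) (A : Set (Sym2 V)) :
    Set (SimpleGraph V) :=
  {T | T ≤ G ∧ T.IsTree ∧ A ⊆ T.edgeSet}

theorem ncard_spanningTreesContaining_star_eq_card_parentMaps {α β : Type*} [Finite α] [Finite β]
    (S : Finset β) :
    (spanningTreesContaining (completeBipartiteGraph (Option α) β)
      ((fun y => s(.inl none, .inr y)) '' S)).ncard =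
    Nat.card {f : (α → β) × (β → Option α) //
          AcyclicFun (f.2 ∘ f.1) ∧ ∀ y ∈ S, f.2 y = none} := by
  rw [← Set.coe_ofPred, Nat.card_coe_set_eq]
  symm
  refine Set.ncard_congr (fun f _ => parentGraph f.1 f.2) ?_ ?_ ?_
  · rintro ⟨p, q⟩ ⟨h, hS⟩
    refine ⟨parentGraph_le p q, parentGraph_isTree h, ?_⟩
    rintro _ ⟨y, hy, rfl⟩
    exact (parentGraph_adj p q none y).2 (.inr (hS y hy))
  · rintro ⟨p, q⟩ ⟨p', q'⟩ - ⟨h, -⟩ heq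
    exact Prod.ext_iff.2 (eq_of_parentGraph_eq h heq)
  · rintro T ⟨hle, hT, hA⟩
    obtain ⟨p, q, hac, rfl⟩ := exists_parentGraph_eq hT hle
    refine ⟨(p, q), ⟨hac, fun y hy => ?_⟩, rfl⟩
    have := (parentGraph_adj p q none y).1 (hA ⟨y, hy, rfl⟩)
    simpa using this

theorem ncard_spanningTreesContaining_map {V W : Type*} {G : SimpleGraph V} {H : SimpleGraph W}
    (φ : G ≃g H) (A : Set (Sym2 V)) :
    (spanningTreesContaining H (Sym2.map φ '' A)).ncard = (spanningTreesContaining G A).ncard := by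
  have h : spanningTreesContaining H (Sym2.map φ '' A) =
      φ.toEquiv.simpleGraph '' spanningTreesContaining G A := by
    have key (T : SimpleGraph V) : φ.toEquiv.simpleGraph T ∈
        spanningTreesContaining H (Sym2.map φ '' A) ↔ T ∈ spanningTreesContaining G A := by
      have hadj (x y : V) : (φ.toEquiv.simpleGraph T).Adj (φ x) (φ y) ↔ T.Adj x y := by
        change T.Adj (φ.toEquiv.symm (φ.toEquiv x)) (φ.toEquiv.symm (φ.toEquiv y)) ↔ _
        rw [Equiv.symm_apply_apply, Equiv.symm_apply_apply]
      refine and_congr ?_ (and_congr ?_ ?_)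
      · constructor
        · intro h x y hxy
          rw [← φ.map_adj_iff]
          exact h ((hadj x y).2 hxy)
        · intro h x y hxy
          rw [← φ.symm.map_adj_iff]
          exact h hxy
      · exact (SimpleGraph.Iso.comap φ.toEquiv.symm T).isTree_iff
      · rw [Set.image_subset_iff]
        refine forall₂_congr fun e _ => ?_
        induction e with
        | _ x y => exact hadj x y
    ext T
    obtain ⟨T, rfl⟩ := φ.toEquiv.simpleGraph.surjective T
    rw [key, (Equiv.injective _).mem_set_image]
  rw [h, Set.ncard_image_of_injective _ (Equiv.injective _)]

/-- Bijections between the parts induce an isomorphism of complete bipartite graphs. -/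
def completeBipartiteGraphCongr {X Y X' Y' : Type*} (σ : X ≃ X') (τ : Y ≃ Y') :
    completeBipartiteGraph X Y ≃g completeBipartiteGraph X' Y' where
  toEquiv := σ.sumCongr τ
  map_rel_iff' := by rintro (x | x) (y | y) <;> simp

/-- Exchanging the parts of a complete bipartite graph is an isomorphism. -/
def completeBipartiteGraphComm (X Y : Type*) :
    completeBipartiteGraph X Y ≃g completeBipartiteGraph Y X where
  toEquiv := .sumComm X Y
  map_rel_iff' := by rintro (x | x) (y | y) <;> simp

theorem sum_ncard_spanningTreesContaining_insert {X Y : Type*} [Fintype X] [Fintype Y]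
    (A : Set (Sym2 (X ⊕ Y))) :
    ∑ z : X × Y, (spanningTreesContaining (completeBipartiteGraph X Y)
        (insert s(.inl z.1, .inr z.2) A)).ncard =
      (Fintype.card X + Fintype.card Y - 1) *
        (spanningTreesContaining (completeBipartiteGraph X Y) A).ncard := by
  classical
  set 𝒯 := (spanningTreesContaining (completeBipartiteGraph X Y) A).toFinite.toFinset with h𝒯
  have hcard (z : X × Y) : (spanningTreesContaining (completeBipartiteGraph X Y)
      (insert s(.inl z.1, .inr z.2) A)).ncard = #{T ∈ 𝒯 | T.Adj (.inl z.1) (.inr z.2)} := by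
    rw [← Set.ncard_coe_finset]
    congr 1
    ext T
    simp [h𝒯, spanningTreesContaining, Set.insert_subset_iff]
    tauto
  have hedges (T) (hT : T ∈ 𝒯) :
      #{z : X × Y | T.Adj (.inl z.1) (.inr z.2)} = Fintype.card X + Fintype.card Y - 1 := by
    rw [Set.Finite.mem_toFinset] at hT
    obtain ⟨hle, hT, -⟩ := hT
    have h1 := (SimpleGraph.isTree_iff_connected_and_card.1 hT).2
    have h2 : T.edgeSet = (fun z : X × Y => s(.inl z.1, .inr z.2)) ''
        {z : X × Y | T.Adj (.inl z.1) (.inr z.2)} := by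
      ext e
      constructor
      · intro he
        induction e with
        | _ u v =>
        rcases u with x | x <;> rcases v with y | y
        · simpa using hle he
        · exact ⟨(x, y), he, rfl⟩
        · exact ⟨(y, x), he.symm, Sym2.eq_swap⟩
        · simpa using hle he
      · rintro ⟨z, hz, rfl⟩
        exact hz
    rw [Nat.card_coe_set_eq, h2, Set.ncard_image_of_injective, Nat.card_sum,
      Nat.card_eq_fintype_card, Nat.card_eq_fintype_card] at h1
    · rw [← h1, Nat.add_sub_cancel, ← Set.ncard_coe_finset]
      simp
    · rintro ⟨x, y⟩ ⟨x', y'⟩ h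
      simpa using h
  simp only [hcard, card_filter _ 𝒯]
  rw [sum_comm]
  simp only [← card_filter]
  rw [sum_congr rfl hedges, sum_const, smul_eq_mul, mul_comm,
    Set.ncard_eq_toFinset_card _ (Set.toFinite _)]

theorem ncard_spanningTreesContaining_star {X Y : Type*} [Fintype X] [Fintype Y]
    (x : X) (S : Finset Y) :
    Fintype.card Y * Fintype.card X * (spanningTreesContaining (completeBipartiteGraph X Y)
        ((fun y => s(.inl x, .inr y)) '' S)).ncard =
      Fintype.card Y ^ (Fintype.card X - 1) * Fintype.card X ^ (Fintype.card Y - #S) *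
        (#S * Fintype.card X + (Fintype.card Y - #S)) := by
  classical
  have h := card_parentMaps (α := {a // a ≠ x}) S
  rw [← ncard_spanningTreesContaining_star_eq_card_parentMaps,
    ← ncard_spanningTreesContaining_map
      (completeBipartiteGraphCongr (Equiv.optionSubtypeNe x) (.refl Y)),
    ← Fintype.card_option, Fintype.card_congr (Equiv.optionSubtypeNe x), Set.image_image] at h
  have hcard : Fintype.card {a // a ≠ x} = Fintype.card X - 1 := by
    simp [Fintype.card_subtype_compl]
  rw [hcard] at h
  simpa [completeBipartiteGraphCongr] using h

theorem natCast_pow_eq_zpow {a : ℕ} (ha : a ≠ 0) {k l : ℕ} {z : ℤ} (h : (k : ℤ) = z + l) :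
    (a : ℚ) ^ k = (a : ℚ) ^ z * (a : ℚ) ^ l := by
  have ha' : (a : ℚ) ≠ 0 := Nat.cast_ne_zero.2 ha
  rw [← zpow_natCast, h, zpow_add₀ ha', zpow_natCast]

theorem ncard_spanningTreesContaining_singleton {X Y : Type*} [Fintype X] [Fintype Y]
    (x : X) (y : Y) :
    ((spanningTreesContaining (completeBipartiteGraph X Y) {s(.inl x, .inr y)}).ncard : ℚ) =
      (Fintype.card Y : ℚ) ^ ((Fintype.card X : ℤ) - 3) *
        (Fintype.card X : ℚ) ^ ((Fintype.card Y : ℤ) - 3) *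
        (Fintype.card X * Fintype.card Y * (Fintype.card X + Fintype.card Y - 1)) := by
  have hX : 0 < Fintype.card X := Fintype.card_pos_iff.2 ⟨x⟩
  have hY : 0 < Fintype.card Y := Fintype.card_pos_iff.2 ⟨y⟩
  have h := congrArg (Nat.cast : ℕ → ℚ) (ncard_spanningTreesContaining_star x {y})
  simp only [coe_singleton, Set.image_singleton, card_singleton] at h
  push_cast [Nat.cast_sub hY] at h
  rw [natCast_pow_eq_zpow hY.ne' (l := 2) (z := (Fintype.card X : ℤ) - 3) (by omega),
    natCast_pow_eq_zpow hX.ne' (l := 2) (z := (Fintype.card Y : ℤ) - 3) (by omega)] at h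
  have hne : (Fintype.card Y : ℚ) * Fintype.card X ≠ 0 := by positivity
  refine mul_left_cancel₀ hne (h.trans ?_)
  ring

theorem ncard_spanningTreesContaining_pair_left {X Y : Type*} [Fintype X] [Fintype Y]
    (x : X) {y y' : Y} (hyy' : y ≠ y') :
    ((spanningTreesContaining (completeBipartiteGraph X Y)
        {s(.inl x, .inr y), s(.inl x, .inr y')}).ncard : ℚ) =
      (Fintype.card Y : ℚ) ^ ((Fintype.card X : ℤ) - 3) *
        (Fintype.card X : ℚ) ^ ((Fintype.card Y : ℤ) - 3) *
        (Fintype.card Y * (2 * Fintype.card X + Fintype.card Y - 2)) := by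
  classical
  have hX : 0 < Fintype.card X := Fintype.card_pos_iff.2 ⟨x⟩
  have hY : 1 < Fintype.card Y := Fintype.one_lt_card_iff.2 ⟨y, y', hyy'⟩
  have h := congrArg (Nat.cast : ℕ → ℚ) (ncard_spanningTreesContaining_star x {y, y'})
  simp only [coe_pair, Set.image_pair, card_pair hyy'] at h
  push_cast [Nat.cast_sub (show 2 ≤ Fintype.card Y from hY)] at h
  rw [natCast_pow_eq_zpow (by omega) (l := 2) (z := (Fintype.card X : ℤ) - 3) (by omega),
    natCast_pow_eq_zpow hX.ne' (l := 1) (z := (Fintype.card Y : ℤ) - 3) (by omega)] at h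
  have hne : (Fintype.card Y : ℚ) * Fintype.card X ≠ 0 := by positivity
  refine mul_left_cancel₀ hne (h.trans ?_)
  ring

theorem ncard_spanningTreesContaining_pair_right {X Y : Type*} [Fintype X] [Fintype Y]
    {x x' : X} (hxx' : x ≠ x') (y : Y) :
    ((spanningTreesContaining (completeBipartiteGraph X Y)
        {s(.inl x, .inr y), s(.inl x', .inr y)}).ncard : ℚ) =
      (Fintype.card Y : ℚ) ^ ((Fintype.card X : ℤ) - 3) *
        (Fintype.card X : ℚ) ^ ((Fintype.card Y : ℤ) - 3) *
        (Fintype.card X * (2 * Fintype.card Y + Fintype.card X - 2)) := by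
  have h := ncard_spanningTreesContaining_pair_left y hxx'
  rw [← ncard_spanningTreesContaining_map (completeBipartiteGraphComm Y X), Set.image_pair] at h
  simp only [completeBipartiteGraphComm, Sym2.map_mk, RelIso.coe_fn_mk, Equiv.sumComm_apply,
    Sum.swap_inl, Sum.swap_inr, Sym2.eq_swap (a := Sum.inr _)] at h
  rw [h]
  ring

theorem ncard_spanningTreesContaining_pair_congr {X Y : Type*} {x x₁ x₂ : X} {y y₁ y₂ : Y}
    (hx₁ : x₁ ≠ x) (hx₂ : x₂ ≠ x) (hy₁ : y₁ ≠ y) (hy₂ : y₂ ≠ y) :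
    (spanningTreesContaining (completeBipartiteGraph X Y)
        {s(.inl x, .inr y), s(.inl x₁, .inr y₁)}).ncard =
      (spanningTreesContaining (completeBipartiteGraph X Y)
        {s(.inl x, .inr y), s(.inl x₂, .inr y₂)}).ncard := by
  classical
  rw [← ncard_spanningTreesContaining_map
    (completeBipartiteGraphCongr (Equiv.swap x₁ x₂) (Equiv.swap y₁ y₂)), Set.image_pair]
  simp [completeBipartiteGraphCongr, Equiv.swap_apply_of_ne_of_ne hx₁.symm hx₂.symm,
    Equiv.swap_apply_of_ne_of_ne hy₁.symm hy₂.symm]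

theorem ncard_spanningTreesContaining_pair_disjoint {X Y : Type*} [Fintype X] [Fintype Y]
    {x x' : X} {y y' : Y} (hx : x' ≠ x) (hy : y' ≠ y) :
    ((spanningTreesContaining (completeBipartiteGraph X Y)
        {s(.inl x, .inr y), s(.inl x', .inr y')}).ncard : ℚ) =
      (Fintype.card Y : ℚ) ^ ((Fintype.card X : ℤ) - 3) *
        (Fintype.card X : ℚ) ^ ((Fintype.card Y : ℤ) - 3) *
        ((Fintype.card X + Fintype.card Y) * (Fintype.card X + Fintype.card Y - 2)) := by
  classical
  have hX : 1 < Fintype.card X := Fintype.one_lt_card_iff.2 ⟨x', x, hx⟩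
  have hY : 1 < Fintype.card Y := Fintype.one_lt_card_iff.2 ⟨y', y, hy⟩
  have h := congrArg (Nat.cast : ℕ → ℚ)
    (sum_ncard_spanningTreesContaining_insert ({s(.inl x, .inr y)} : Set (Sym2 (X ⊕ Y))))
  rw [Fintype.sum_prod_type, ← add_sum_erase _ _ (mem_univ x), ← add_sum_erase _ _ (mem_univ y)]
    at h
  have hrest : ∀ a ∈ univ.erase x, ∑ b : Y, (spanningTreesContaining (completeBipartiteGraph X Y)
        {s(.inl a, .inr b), s(.inl x, .inr y)}).ncard =
      (spanningTreesContaining (completeBipartiteGraph X Y)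
        {s(.inl a, .inr y), s(.inl x, .inr y)}).ncard +
      (Fintype.card Y - 1) * (spanningTreesContaining (completeBipartiteGraph X Y)
        {s(.inl x, .inr y), s(.inl x', .inr y')}).ncard := by
    intro a ha
    rw [← add_sum_erase _ _ (mem_univ y), sum_congr rfl fun b hb => by
      rw [Set.pair_comm, ncard_spanningTreesContaining_pair_congr (ne_of_mem_erase ha) hx
        (ne_of_mem_erase hb) hy]]
    simp
  rw [sum_congr rfl hrest, sum_add_distrib, sum_const, card_erase_of_mem (mem_univ x),
    Set.pair_eq_singleton, card_univ, smul_eq_mul] at h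
  push_cast [Nat.cast_sub hX.le, Nat.cast_sub hY.le,
    Nat.cast_sub (show 1 ≤ Fintype.card X + Fintype.card Y by omega)] at h
  rw [sum_congr rfl fun b hb => ncard_spanningTreesContaining_pair_left x (ne_of_mem_erase hb),
    sum_congr rfl fun a ha => ncard_spanningTreesContaining_pair_right (ne_of_mem_erase ha) y,
    ncard_spanningTreesContaining_singleton, sum_const, sum_const,
    card_erase_of_mem (mem_univ x), card_erase_of_mem (mem_univ y), card_univ, card_univ,
    nsmul_eq_mul, nsmul_eq_mul, Nat.cast_sub hX.le, Nat.cast_sub hY.le, Nat.cast_one] at h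
  have hX' : (Fintype.card X : ℚ) - 1 ≠ 0 := sub_ne_zero.2 (by exact_mod_cast hX.ne')
  have hY' : (Fintype.card Y : ℚ) - 1 ≠ 0 := sub_ne_zero.2 (by exact_mod_cast hY.ne')
  refine mul_left_cancel₀ (mul_ne_zero hX' hY') ?_
  linear_combination h

theorem exists_eq_of_mem_edgeSet_completeBipartiteGraph {X Y : Type*} {e : Sym2 (X ⊕ Y)}
    (he : e ∈ (completeBipartiteGraph X Y).edgeSet) : ∃ x y, e = s(.inl x, .inr y) := by
  induction e with
  | _ u v =>
  rcases u with x | x <;> rcases v with y | y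
  · simp at he
  · exact ⟨x, y, rfl⟩
  · exact ⟨y, x, Sym2.eq_swap⟩
  · simp at he

/-- Numbers of spanning trees of the complete bipartite graph `K_{m,n}` containing two
distinct edges `e, f`, according as they share a vertex in the part `X` of size `m`,
share a vertex in the part `Y` of size `n`, or are vertex-disjoint. -/
theorem stmt_10 (m n : ℕ) (hm : 1 ≤ m) (hn : 1 ≤ n) (hmn : 3 ≤ m + n)
    (e f : Sym2 (Fin m ⊕ Fin n))
    (he : e ∈ (completeBipartiteGraph (Fin m) (Fin n)).edgeSet)
    (hf : f ∈ (completeBipartiteGraph (Fin m) (Fin n)).edgeSet)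
    (hef : e ≠ f) :
    ((∃ x : Fin m, Sum.inl x ∈ e ∧ Sum.inl x ∈ f) →
      ({T : SimpleGraph (Fin m ⊕ Fin n) |
          T ≤ completeBipartiteGraph (Fin m) (Fin n) ∧ T.IsTree ∧
          e ∈ T.edgeSet ∧ f ∈ T.edgeSet}.ncard : ℚ)
        = (n : ℚ) ^ ((m : ℤ) - 3) * (m : ℚ) ^ ((n : ℤ) - 3) *
            ((n : ℚ) * (2 * (m : ℚ) + (n : ℚ) - 2))) ∧
    ((∃ y : Fin n, Sum.inr y ∈ e ∧ Sum.inr y ∈ f) →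
      ({T : SimpleGraph (Fin m ⊕ Fin n) |
          T ≤ completeBipartiteGraph (Fin m) (Fin n) ∧ T.IsTree ∧
          e ∈ T.edgeSet ∧ f ∈ T.edgeSet}.ncard : ℚ)
        = (n : ℚ) ^ ((m : ℤ) - 3) * (m : ℚ) ^ ((n : ℤ) - 3) *
            ((m : ℚ) * (2 * (n : ℚ) + (m : ℚ) - 2))) ∧
    ((¬ ∃ v, v ∈ e ∧ v ∈ f) →
      ({T : SimpleGraph (Fin m ⊕ Fin n) |
          T ≤ completeBipartiteGraph (Fin m) (Fin n) ∧ T.IsTree ∧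
          e ∈ T.edgeSet ∧ f ∈ T.edgeSet}.ncard : ℚ)
        = (n : ℚ) ^ ((m : ℤ) - 3) * (m : ℚ) ^ ((n : ℤ) - 3) *
            (((m : ℚ) + (n : ℚ)) * ((m : ℚ) + (n : ℚ) - 2))) := by
  have hset : {T : SimpleGraph (Fin m ⊕ Fin n) |
      T ≤ completeBipartiteGraph (Fin m) (Fin n) ∧ T.IsTree ∧ e ∈ T.edgeSet ∧ f ∈ T.edgeSet} =
      spanningTreesContaining (completeBipartiteGraph (Fin m) (Fin n)) {e, f} := by
    simp only [spanningTreesContaining, Set.insert_subset_iff, Set.singleton_subset_iff]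
  rw [hset]
  obtain ⟨x, y, rfl⟩ := exists_eq_of_mem_edgeSet_completeBipartiteGraph he
  obtain ⟨x', y', rfl⟩ := exists_eq_of_mem_edgeSet_completeBipartiteGraph hf
  refine ⟨?_, ?_, fun h => ?_⟩
  · rintro ⟨a, ha, ha'⟩
    obtain rfl : a = x := by simpa using ha
    obtain rfl : a = x' := by simpa using ha'
    simpa using ncard_spanningTreesContaining_pair_left a (y := y) (y' := y')
      (by rintro rfl; exact hef rfl)
  · rintro ⟨b, hb, hb'⟩
    obtain rfl : b = y := by simpa using hb
    obtain rfl : b = y' := by simpa using hb'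
    simpa using ncard_spanningTreesContaining_pair_right (x := x) (x' := x')
      (by rintro rfl; exact hef rfl) b
  · simpa using ncard_spanningTreesContaining_pair_disjoint (x := x) (x' := x') (y := y)
      (y' := y') (by rintro rfl; exact h ⟨.inl x', by simp, by simp⟩)
      (by rintro rfl; exact h ⟨.inr y', by simp, by simp⟩)
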